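/- arXiv:1209.0022 — 2 statements merged into one kernel-verified Lean document; each statement's English description precedes it below -/
import Mathlib

section
/- Let E be an integral lattice (a finitely generated free ℤ-module with ℤ-valued symmetric bilinear form), let α ∈ E be a root of E (α·α > 0 and x·α ∈ (α·α/2)ℤ for all x ∈ E), and suppose α is imprimitive, i.e., α = kβ for some β ∈ E and integer k ≥ 2. Then k = 2, and E decomposes as the orthogonal direct sum E = ℤβ ⊕ (E ∩ β^⊥); that is, β = α/2 spans an orthogonal direct summand of E. -/
/-- Let `E` be an integral lattice (a finitely generated free `ℤ`-module
with `ℤ`-valued symmetric bilinear form), let `α ∈ E` be a root of `E` (`α·α > 0` and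
`x·α ∈ (α·α/2)ℤ` for all `x ∈ E`), and suppose `α` is imprimitive, i.e. `α = kβ` for some
`β ∈ E` and integer `k ≥ 2`.  Then `k = 2`, and `E` decomposes as the orthogonal direct
sum `E = ℤβ ⊕ (E ∩ β^⊥)`; that is, `β = α/2` spans an orthogonal direct summand of `E`. -/
theorem imprimitive_root_splits_lattice
    {E : Type*} [AddCommGroup E] [Module ℤ E] [Module.Free ℤ E] [Module.Finite ℤ E]
    (B : LinearMap.BilinForm ℤ E) (hsymm : ∀ x y : E, B x y = B y x)
    (α : E) (hα : 0 < B α α) (hroot : ∀ x : E, B α α ∣ 2 * B x α)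
    (β : E) (k : ℤ) (hk : 2 ≤ k) (hαβ : α = k • β) :
    k = 2 ∧ IsCompl (Submodule.span ℤ {β}) (LinearMap.ker (B.flip β)) := by
  subst hαβ
  have e : ∀ x : E, B x (k • β) = k * B x β := fun x => by simp
  have e2 : B (k • β) (k • β) = k * (k * B β β) := by simp
  rw [e2] at hα hroot
  have hk0 : (k : ℤ) ≠ 0 := by omega
  have hn : 0 < B β β := by
    have h1 : 0 < k * B β β := pos_of_mul_pos_right hα (by omega)
    exact pos_of_mul_pos_right h1 (by omega)
  have key : ∀ x : E, k * B β β ∣ 2 * B x β := fun x => by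
    have h := hroot x
    rw [e, show 2 * (k * B x β) = k * (2 * B x β) by ring] at h
    exact Int.dvd_of_mul_dvd_mul_left hk0 h
  have k2 : k = 2 := by
    have h : k ∣ 2 := Int.dvd_of_mul_dvd_mul_right hn.ne' (key β)
    have := Int.le_of_dvd (by norm_num) h
    omega
  refine ⟨k2, ?_⟩
  subst k2
  have dv : ∀ x : E, B β β ∣ B x β := fun x =>
    Int.dvd_of_mul_dvd_mul_left (by norm_num) (key x)
  rw [isCompl_iff, Submodule.disjoint_def, codisjoint_iff, Submodule.eq_top_iff']
  constructor
  · intro x hx hx'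
    obtain ⟨c, rfl⟩ := Submodule.mem_span_singleton.1 hx
    have h : c * B β β = 0 := by simpa using hx'
    rcases mul_eq_zero.1 h with h | h
    · simp [h]
    · omega
  · intro x
    obtain ⟨c, hc⟩ := dv x
    refine Submodule.mem_sup.2 ⟨c • β, zsmul_mem (Submodule.mem_span_singleton_self β) c,
      x - c • β, ?_, by abel⟩
    simp [hc, mul_comm]
end

section
/- Let E be an integral lattice and let α ∈ E be a root of E (α·α > 0 and x·α ∈ (α·α/2)ℤ for all x ∈ E). Then exactly one of the following holds: (a) x·α ∈ (α·α)ℤ for all x ∈ E, and E = ℤα ⊕ (E ∩ α^⊥) as an orthogonal direct sum; or (b) the sublattice E' := {x ∈ E : x·α ∈ (α·α)ℤ} has index 2 in E, contains α, and decomposes as the orthogonal direct sum E' = ℤα ⊕ (E' ∩ α^⊥). -/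
/-- Let `E` be an integral lattice and let `α ∈ E` be a root of `E`
(`α·α > 0` and `x·α ∈ (α·α/2)ℤ` for all `x ∈ E`).  Then exactly one of the following
holds: (a) `x·α ∈ (α·α)ℤ` for all `x ∈ E`, and `E = ℤα ⊕ (E ∩ α^⊥)` as an orthogonal
direct sum; or (b) the sublattice `E' = {x ∈ E : x·α ∈ (α·α)ℤ}` has index 2 in `E`,
contains `α`, and decomposes as the orthogonal direct sum `E' = ℤα ⊕ (E' ∩ α^⊥)`. -/
theorem root_dichotomy_orthogonal_splitting
    {E : Type*} [AddCommGroup E] [Module ℤ E] [Module.Free ℤ E] [Module.Finite ℤ E]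
    (B : LinearMap.BilinForm ℤ E) (hsymm : ∀ x y : E, B x y = B y x)
    (α : E) (hα : 0 < B α α) (hroot : ∀ x : E, B α α ∣ 2 * B x α)
    (E' : Submodule ℤ E) (hE' : ∀ x : E, x ∈ E' ↔ B α α ∣ B x α) :
    Xor'
      ((∀ x : E, B α α ∣ B x α) ∧
        ∀ x : E, ∃! p : ℤ × E, B p.2 α = 0 ∧ x = p.1 • α + p.2)
      (E'.toAddSubgroup.index = 2 ∧ α ∈ E' ∧
        ∀ x ∈ E', ∃! p : ℤ × E, p.2 ∈ E' ∧ B p.2 α = 0 ∧ x = p.1 • α + p.2) := by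
  have sm : ∀ n : ℤ, B (n • α) α = n * B α α := by intro n; simp
  have hne : B α α ≠ 0 := hα.ne'
  have dec : ∀ x, B α α ∣ B x α → ∃! p : ℤ × E, B p.2 α = 0 ∧ x = p.1 • α + p.2 := by
    rintro x ⟨c, hc⟩
    refine ⟨(c, x - c • α), ⟨?_, ?_⟩, ?_⟩
    · show B (x - c • α) α = 0
      rw [map_sub, LinearMap.sub_apply, sm, hc]; ring
    · show x = c • α + (x - c • α)
      abel
    · rintro ⟨n, y⟩ ⟨h1, h2⟩
      simp only at h1 h2
      have h3 : B x α = n * B α α := by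
        rw [h2, map_add, LinearMap.add_apply, sm, h1, add_zero]
      have h4 : n = c := by
        apply mul_right_cancel₀ hne
        rw [← h3, hc]; ring
      subst h4
      rw [Prod.mk.injEq]
      exact ⟨rfl, by rw [h2, add_sub_cancel_left]⟩
  have key : ∀ x, ∃ k : ℤ, 2 * B x α = B α α * k ∧ (x ∈ E' ↔ 2 ∣ k) := by
    intro x
    obtain ⟨k, hk⟩ := hroot x
    refine ⟨k, hk, ?_⟩
    rw [hE']
    constructor
    · rintro ⟨c, hc⟩
      refine ⟨c, mul_left_cancel₀ hne ?_⟩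
      rw [← hk, hc]; ring
    · rintro ⟨c, rfl⟩
      exact ⟨c, by linarith⟩
  by_cases h : ∀ x, B α α ∣ B x α
  · left
    refine ⟨⟨h, fun x => dec x (h x)⟩, ?_⟩
    rintro ⟨h2, -⟩
    have ht : E'.toAddSubgroup = ⊤ := by
      ext x
      simp [hE', h x]
    rw [ht, AddSubgroup.index_top] at h2
    omega
  · right
    refine ⟨⟨?_, (hE' α).2 dvd_rfl, ?_⟩, fun h' => h h'.1⟩
    · push Not at h
      obtain ⟨a, ha⟩ := h
      rw [← hE'] at ha
      rw [AddSubgroup.index_eq_two_iff]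
      refine ⟨a, fun b => ?_⟩
      simp only [Submodule.mem_toAddSubgroup]
      obtain ⟨k, hk, hk'⟩ := key a
      obtain ⟨l, hl, hl'⟩ := key b
      obtain ⟨m, hm, hm'⟩ := key (b + a)
      have hs : m = l + k := by
        apply mul_left_cancel₀ hne
        rw [← hm, map_add, LinearMap.add_apply, mul_add, mul_add, hk, hl]
      rw [hk'] at ha
      rw [hm', hl', xor_iff_not_iff]
      omega
    · intro x hx
      obtain ⟨p, hp, hu⟩ := dec x ((hE' x).1 hx)
      exact ⟨p, ⟨(hE' _).2 (by rw [hp.1]; exact dvd_zero _), hp⟩, fun q hq => hu q hq.2⟩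
end
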